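/- Fix an integer m ≥ 1 and a real number α ≠ 0, set n = 2m, and let ω be the standard symplectic n×n matrix J = [[0, Id_m],[−Id_m, 0]]. Let E be the space of skew-symmetric n×n real matrices, and consider on E the symmetric bilinear form γ^α_ω(h,k) = tr((ω⁻¹h)₀(ω⁻¹k)₀) + α·tr(ω⁻¹h)·tr(ω⁻¹k), where A₀ = A − (tr(A)/n)·I. Then there exist subspaces P and N of E with E = P ⊕ N, γ^α_ω(x,y) = 0 for all x ∈ P, y ∈ N, γ^α_ω positive definite on P and negative definite on N, and dim N = m² − m if α > 0, while dim N = m² − m + 1 if α < 0. -/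

import Mathlib

open Matrix

/-- The subspace of skew-symmetric matrices. -/
def skewSub (m : Type*) [Fintype m] [DecidableEq m] :
    Submodule ℝ (Matrix m m ℝ) where
  carrier := {A | Aᵀ = -A}
  add_mem' := by
    intro A B hA hB
    simp only [Set.mem_setOf_eq, Matrix.transpose_add] at *
    rw [hA, hB]; abel
  zero_mem' := by simp
  smul_mem' := by
    intro c A hA
    simp only [Set.mem_setOf_eq, Matrix.transpose_smul] at *
    rw [hA]; module

/-- The bilinear form `γ^α_ω(h,k) = tr((ω⁻¹h)₀(ω⁻¹k)₀) + α·tr(ω⁻¹h)·tr(ω⁻¹k)`,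
where `A₀ = A − (tr(A)/n)·I` and `n` is the size of the matrices. -/
noncomputable def gammaAlphaAt (m : Type*) [Fintype m] [DecidableEq m] (α : ℝ)
    (ω h k : Matrix m m ℝ) : ℝ :=
  (((ω⁻¹ * h) - ((ω⁻¹ * h).trace / (Fintype.card m : ℝ)) • (1 : Matrix m m ℝ)) *
      ((ω⁻¹ * k) - ((ω⁻¹ * k).trace / (Fintype.card m : ℝ)) • (1 : Matrix m m ℝ))).trace +
    α * (ω⁻¹ * h).trace * (ω⁻¹ * k).trace


def sPlus {n : Type*} [Fintype n] [DecidableEq n] (ω : Matrix n n ℝ) :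
    Submodule ℝ (Matrix n n ℝ) where
  carrier := {h | hᵀ = -h ∧ ω * h = h * ω}
  add_mem' := by
    rintro a b ⟨h1, h2⟩ ⟨h3, h4⟩
    refine ⟨?_, ?_⟩
    · rw [transpose_add, h1, h3]; abel
    · rw [mul_add, add_mul, h2, h4]
  zero_mem' := by simp
  smul_mem' := by
    rintro c a ⟨h1, h2⟩
    refine ⟨?_, ?_⟩
    · rw [transpose_smul, h1]; module
    · rw [mul_smul_comm, smul_mul_assoc, h2]

def sMinus {n : Type*} [Fintype n] [DecidableEq n] (ω : Matrix n n ℝ) :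
    Submodule ℝ (Matrix n n ℝ) where
  carrier := {h | hᵀ = -h ∧ ω * h = -(h * ω)}
  add_mem' := by
    rintro a b ⟨h1, h2⟩ ⟨h3, h4⟩
    refine ⟨?_, ?_⟩
    · rw [transpose_add, h1, h3]; abel
    · rw [mul_add, add_mul, h2, h4]; abel
  zero_mem' := by simp
  smul_mem' := by
    rintro c a ⟨h1, h2⟩
    refine ⟨?_, ?_⟩
    · rw [transpose_smul, h1]; module
    · rw [mul_smul_comm, smul_mul_assoc, h2]; module

def sZero {n : Type*} [Fintype n] [DecidableEq n] (ω : Matrix n n ℝ) :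
    Submodule ℝ (Matrix n n ℝ) where
  carrier := {h | (ω * h).trace = 0}
  add_mem' := by
    intro a b h1 h2
    simp only [Set.mem_ofPred_eq] at *
    rw [mul_add, trace_add, h1, h2, add_zero]
  zero_mem' := by simp
  smul_mem' := by
    intro c a h1
    simp only [Set.mem_ofPred_eq] at *
    rw [mul_smul_comm, trace_smul, h1, smul_zero]

section gen
variable {n : Type*} [Fintype n] [DecidableEq n]

lemma frob_pos (h : Matrix n n ℝ) (hs : hᵀ = -h) (h0 : h ≠ 0) : (h * h).trace < 0 := by
  have h1 : 0 ≤ (hᵀ * h).trace := by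
    have := (Matrix.posSemidef_conjTranspose_mul_self h).trace_nonneg
    simpa using this
  have h2 : (hᵀ * h).trace ≠ 0 := by
    intro h3
    apply h0
    have := (Matrix.trace_conjTranspose_mul_self_eq_zero_iff (A := h)).1 (by simpa using h3)
    exact this
  have h4 : (hᵀ * h).trace = -(h * h).trace := by rw [hs, neg_mul, trace_neg]
  have := lt_of_le_of_ne h1 (Ne.symm h2)
  linarith

lemma gamma_eq [Nonempty n] (α : ℝ) (ω h k : Matrix n n ℝ) (hw : ω * ω = -1) :
    gammaAlphaAt n α ω h k = (ω * h * (ω * k)).trace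
      + (α - 1 / (Fintype.card n : ℝ)) * (ω * h).trace * (ω * k).trace := by
  have hi : ω⁻¹ = -ω := by
    apply Matrix.inv_eq_right_inv
    rw [mul_neg, hw, neg_neg]
  have hc : (Fintype.card n : ℝ) ≠ 0 := by
    exact_mod_cast Fintype.card_ne_zero
  unfold gammaAlphaAt
  rw [hi]
  simp only [neg_mul, trace_neg, sub_mul, mul_sub, trace_sub, mul_neg, smul_mul_assoc,
    mul_smul_comm, trace_smul, one_mul, mul_one, trace_one, smul_eq_mul, neg_neg]
  field_simp
  ring

lemma tr_plus (ω h k : Matrix n n ℝ) (hw : ω * ω = -1) (hh : ω * h = h * ω) :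
    (ω * h * (ω * k)).trace = -(h * k).trace := by
  rw [hh, Matrix.mul_assoc, ← Matrix.mul_assoc ω ω k, hw]
  simp

lemma tr_minus (ω h k : Matrix n n ℝ) (hw : ω * ω = -1) (hh : ω * h = -(h * ω)) :
    (ω * h * (ω * k)).trace = (h * k).trace := by
  rw [hh, neg_mul, Matrix.mul_assoc, ← Matrix.mul_assoc ω ω k, hw]
  simp

lemma tr_minus0 (ω h : Matrix n n ℝ) (hh : ω * h = -(h * ω)) : (ω * h).trace = 0 := by
  have h1 : (ω * h).trace = -(ω * h).trace := by
    conv_lhs => rw [hh, trace_neg, trace_mul_comm]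
  linarith

lemma tr_mixed (ω h k : Matrix n n ℝ) (hw : ω * ω = -1) (hh : ω * h = h * ω)
    (hk : ω * k = -(k * ω)) : (h * k).trace = 0 := by
  have h1 := tr_plus ω h k hw hh
  have h2 := tr_minus ω k h hw hk
  rw [trace_mul_comm, trace_mul_comm k] at h2
  linarith

lemma gamma_mixed [Nonempty n] (α : ℝ) (ω h k : Matrix n n ℝ) (hw : ω * ω = -1)
    (hh : h ∈ sPlus ω) (hk : k ∈ sMinus ω) : gammaAlphaAt n α ω h k = 0 := by
  rw [gamma_eq α ω h k hw, tr_plus ω h k hw hh.2, tr_mixed ω h k hw hh.2 hk.2,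
    tr_minus0 ω k hk.2]
  simp

lemma split_pm (ω h : Matrix n n ℝ) (hw : ω * ω = -1) (hwt : ωᵀ = -ω) (hs : hᵀ = -h) :
    ∃ a ∈ sPlus ω, ∃ b ∈ sMinus ω, a + b = h := by
  have e1 : ω * (ω * h * ω) = -(h * ω) := by
    rw [← Matrix.mul_assoc, ← Matrix.mul_assoc, hw]; simp
  have e2 : (ω * h * ω) * ω = -(ω * h) := by
    rw [Matrix.mul_assoc, hw]; simp
  have e3 : (ω * h * ω)ᵀ = -(ω * h * ω) := by
    rw [transpose_mul, transpose_mul, hwt, hs]; simp [Matrix.mul_assoc]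
  refine ⟨(1/2 : ℝ) • (h - ω * h * ω), ⟨?_, ?_⟩, (1/2 : ℝ) • (h + ω * h * ω), ⟨?_, ?_⟩, ?_⟩
  · rw [transpose_smul, transpose_sub, e3, hs]; module
  · rw [mul_smul_comm, smul_mul_assoc, mul_sub, sub_mul, e1, e2]; module
  · rw [transpose_smul, transpose_add, e3, hs]; module
  · rw [mul_smul_comm, smul_mul_assoc, mul_add, add_mul, e1, e2]; module
  · module

lemma split_zero [Nonempty n] (ω h : Matrix n n ℝ) (hw : ω * ω = -1) (hwt : ωᵀ = -ω)
    (hs : h ∈ sPlus ω) :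
    ∃ a ∈ sPlus ω ⊓ sZero ω, ∃ c : ℝ, a + c • ω = h := by
  have hc : (Fintype.card n : ℝ) ≠ 0 := by
    exact_mod_cast Fintype.card_ne_zero
  have hω : ω ∈ sPlus ω := ⟨hwt, rfl⟩
  refine ⟨h - (-(ω * h).trace / (Fintype.card n : ℝ)) • ω,
    ⟨Submodule.sub_mem _ hs (Submodule.smul_mem _ _ hω), ?_⟩,
    -(ω * h).trace / (Fintype.card n : ℝ), by module⟩
  change (ω * _).trace = 0
  rw [mul_sub, trace_sub, mul_smul_comm, trace_smul, hw, trace_neg, trace_one, smul_eq_mul]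
  field_simp
  ring

lemma gamma_zero_omega [Nonempty n] (α : ℝ) (ω h : Matrix n n ℝ) (hw : ω * ω = -1)
    (hh : (ω * h).trace = 0) : gammaAlphaAt n α ω h ω = 0 := by
  rw [gamma_eq α ω h ω hw, hw, hh]; simp [hh]

lemma gamma_plus_zero [Nonempty n] (α : ℝ) (ω h : Matrix n n ℝ) (hw : ω * ω = -1)
    (hh : h ∈ sPlus ω ⊓ sZero ω) : gammaAlphaAt n α ω h h = -(h * h).trace := by
  have : (ω * h).trace = 0 := hh.2
  rw [gamma_eq α ω h h hw, tr_plus ω h h hw hh.1.2, this]; simp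

lemma gamma_add_omega [Nonempty n] (α : ℝ) (ω h : Matrix n n ℝ) (c : ℝ) (hw : ω * ω = -1)
    (hh : (ω * h).trace = 0) :
    gammaAlphaAt n α ω (h + c • ω) (h + c • ω)
      = (ω * h * (ω * h)).trace + α * (c * (Fintype.card n : ℝ)) ^ 2 := by
  have hc : (Fintype.card n : ℝ) ≠ 0 := by
    exact_mod_cast Fintype.card_ne_zero
  rw [gamma_eq α ω _ _ hw]
  simp only [mul_add, add_mul, mul_smul_comm, smul_mul_assoc, hw, trace_add, trace_smul,
    trace_neg, trace_one, smul_eq_mul, mul_neg, neg_mul, mul_one, one_mul, hh, neg_neg]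
  field_simp
  ring

lemma plus_inf_minus (ω : Matrix n n ℝ) (hw : ω * ω = -1) : sPlus ω ⊓ sMinus ω = ⊥ := by
  rw [eq_bot_iff]
  rintro h ⟨h1, h2⟩
  by_contra h0
  have := frob_pos h h1.1 h0
  rw [tr_mixed ω h h hw h1.2 h2.2] at this
  exact lt_irrefl _ this

end gen

def offMap (m : ℕ) : ({p : Fin m × Fin m // p.1 ≠ p.2} → ℝ) →ₗ[ℝ]
    Matrix (Fin m ⊕ Fin m) (Fin m ⊕ Fin m) ℝ where
  toFun f :=
    let A : Matrix (Fin m) (Fin m) ℝ := Matrix.of fun i j =>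
      if h : i < j then f ⟨(i, j), h.ne⟩ else if h : j < i then -f ⟨(j, i), h.ne⟩ else 0
    let B : Matrix (Fin m) (Fin m) ℝ := Matrix.of fun i j =>
      if h : j < i then f ⟨(i, j), h.ne'⟩ else if h : i < j then -f ⟨(j, i), h.ne'⟩ else 0
    Matrix.fromBlocks A B B (-A)
  map_add' f g := by
    ext (i | i) (j | j) <;> simp <;> split_ifs <;> (try simp) <;> (try ring)
  map_smul' c f := by
    ext (i | i) (j | j) <;> simp <;> split_ifs <;> (try simp)

lemma offMap_inj (m : ℕ) : Function.Injective (offMap m) := by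
  rw [injective_iff_map_eq_zero]
  intro f hf
  ext ⟨⟨i, j⟩, hij⟩
  rcases lt_or_gt_of_ne hij with h | h
  · have := congrFun (congrFun hf (Sum.inl i)) (Sum.inl j)
    simp at h
    simpa [offMap, h] using this
  · have := congrFun (congrFun hf (Sum.inl i)) (Sum.inr j)
    simp at h
    simpa [offMap, h] using this

lemma offMap_range (m : ℕ) : LinearMap.range (offMap m) =
    sMinus (Matrix.fromBlocks 0 (1 : Matrix (Fin m) (Fin m) ℝ)
        (-(1 : Matrix (Fin m) (Fin m) ℝ)) 0) := by
  apply le_antisymm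
  · rintro _ ⟨f, rfl⟩
    refine ⟨?_, ?_⟩
    · ext (i | i) (j | j) <;> rcases lt_trichotomy i j with h | h | h <;>
        simp [offMap, h, h.not_gt]
    · simp [offMap, fromBlocks_multiply, fromBlocks_neg]
  · rintro h ⟨h1, h2⟩
    have s : ∀ x y, h y x = - h x y := fun x y => congrFun (congrFun h1 x) y
    have e : h = fromBlocks h.toBlocks₁₁ h.toBlocks₁₂ h.toBlocks₂₁ h.toBlocks₂₂ :=
      (fromBlocks_toBlocks h).symm
    rw [e, fromBlocks_multiply, fromBlocks_multiply, fromBlocks_neg, fromBlocks_inj] at h2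
    simp at h2
    obtain ⟨a1, a2, a3, a4⟩ := h2
    have b1 : ∀ i j, h (Sum.inr i) (Sum.inl j) = h (Sum.inl i) (Sum.inr j) :=
      fun i j => congrFun (congrFun a1 i) j
    have b2 : ∀ i j, h (Sum.inr i) (Sum.inr j) = - h (Sum.inl i) (Sum.inl j) :=
      fun i j => congrFun (congrFun a2 i) j
    refine ⟨fun p => if p.1.1 < p.1.2 then h (Sum.inl p.1.1) (Sum.inl p.1.2)
      else h (Sum.inl p.1.1) (Sum.inr p.1.2), ?_⟩
    have c1 : ∀ i j, h (Sum.inl j) (Sum.inl i) = - h (Sum.inl i) (Sum.inl j) :=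
      fun i j => s _ _
    have c2 : ∀ i j, h (Sum.inl j) (Sum.inr i) = - h (Sum.inl i) (Sum.inr j) :=
      fun i j => by rw [← b1 j i, s]
    ext (i | i) (j | j) <;> rcases lt_trichotomy i j with hh | hh | hh
    all_goals first
      | subst hh
        have := c1 i i
        have := c2 i i
        simp [offMap, b1, b2]
        linarith
      | have := c1 i j
        have := c2 i j
        simp [offMap, hh, hh.not_gt, b1, b2]
        try linarith

lemma finrank_minus (m : ℕ) : Module.finrank ℝ (sMinus (Matrix.fromBlocks 0
    (1 : Matrix (Fin m) (Fin m) ℝ) (-(1 : Matrix (Fin m) (Fin m) ℝ)) 0)) = m ^ 2 - m := by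
  rw [← offMap_range, LinearMap.finrank_range_of_inj (offMap_inj m), Module.finrank_pi]
  have : Fintype.card {p : Fin m × Fin m // p.1 ≠ p.2} = (Finset.univ : Finset (Fin m)).offDiag.card := by
    apply Fintype.card_of_subtype
    simp
  rw [this, Finset.offDiag_card]
  simp [sq]

theorem stmt13 (m : ℕ) (hm : 1 ≤ m) (α : ℝ) (hα : α ≠ 0)
    (ω : Matrix (Fin m ⊕ Fin m) (Fin m ⊕ Fin m) ℝ)
    (hω : ω = Matrix.fromBlocks 0 (1 : Matrix (Fin m) (Fin m) ℝ)
        (-(1 : Matrix (Fin m) (Fin m) ℝ)) 0) :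
    ∃ P N : Submodule ℝ (Matrix (Fin m ⊕ Fin m) (Fin m ⊕ Fin m) ℝ),
      P ≤ skewSub (Fin m ⊕ Fin m) ∧ N ≤ skewSub (Fin m ⊕ Fin m) ∧
      P ⊓ N = ⊥ ∧ P ⊔ N = skewSub (Fin m ⊕ Fin m) ∧
      (∀ x ∈ P, ∀ y ∈ N, gammaAlphaAt (Fin m ⊕ Fin m) α ω x y = 0) ∧
      (∀ x ∈ P, x ≠ 0 → 0 < gammaAlphaAt (Fin m ⊕ Fin m) α ω x x) ∧
      (∀ x ∈ N, x ≠ 0 → gammaAlphaAt (Fin m ⊕ Fin m) α ω x x < 0) ∧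
      (0 < α → Module.finrank ℝ N = m ^ 2 - m) ∧
      (α < 0 → Module.finrank ℝ N = m ^ 2 - m + 1) := by
  have : Nonempty (Fin m ⊕ Fin m) := ⟨Sum.inl ⟨0, hm⟩⟩
  have hw : ω * ω = -1 := by
    rw [hω, fromBlocks_multiply, ← fromBlocks_one, fromBlocks_neg]; simp
  have hwt : ωᵀ = -ω := by
    rw [hω, fromBlocks_transpose, fromBlocks_neg]; simp
  have hdim : Module.finrank ℝ (sMinus ω) = m ^ 2 - m := by
    rw [hω]; exact finrank_minus m
  have hpm := plus_inf_minus ω hw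
  have hωp : ω ∈ sPlus ω := ⟨hwt, rfl⟩
  have hc : (Fintype.card (Fin m ⊕ Fin m) : ℝ) ≠ 0 := by
    exact_mod_cast Fintype.card_ne_zero
  have hω0 : ω ≠ 0 := by
    intro h
    rw [h] at hw
    have := congrArg Matrix.trace hw
    rw [trace_neg, trace_one] at this
    simp only [mul_zero, trace_zero] at this
    exact hc (by linarith)
  have hmneg : ∀ x ∈ sMinus ω, x ≠ 0 → (ω * x * (ω * x)).trace < 0 := by
    intro x hx h0
    rw [tr_minus ω x x hw hx.2]
    exact frob_pos x hx.1 h0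
  rcases lt_or_gt_of_ne hα with hneg | hpos
  · have hNs : ∀ y ∈ sMinus ω ⊔ Submodule.span ℝ {ω}, ∃ b ∈ sMinus ω, ∃ c : ℝ,
        b + c • ω = y := by
      intro y hy
      obtain ⟨b, hb, z, hz, rfl⟩ := Submodule.mem_sup.1 hy
      obtain ⟨c, rfl⟩ := Submodule.mem_span_singleton.1 hz
      exact ⟨b, hb, c, rfl⟩
    have hNneg : ∀ x ∈ sMinus ω ⊔ Submodule.span ℝ {ω}, x ≠ 0 →
        gammaAlphaAt (Fin m ⊕ Fin m) α ω x x < 0 := by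
      intro x hx h0
      obtain ⟨b, hb, c, rfl⟩ := hNs x hx
      rw [gamma_add_omega α ω b c hw (tr_minus0 ω b hb.2)]
      by_cases hb0 : b = 0
      · subst hb0
        have hc0 : c ≠ 0 := by rintro rfl; simp at h0
        have : 0 < (c * (Fintype.card (Fin m ⊕ Fin m) : ℝ)) ^ 2 := by positivity
        simp only [mul_zero, trace_zero, zero_add]
        exact mul_neg_of_neg_of_pos hneg this
      · have := hmneg b hb hb0
        have h2 := sq_nonneg (c * (Fintype.card (Fin m ⊕ Fin m) : ℝ))
        nlinarith
    have hPpos : ∀ x ∈ sPlus ω ⊓ sZero ω, x ≠ 0 →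
        0 < gammaAlphaAt (Fin m ⊕ Fin m) α ω x x := by
      intro x hx h0
      rw [gamma_plus_zero α ω x hw hx]
      have := frob_pos x hx.1.1 h0
      linarith
    refine ⟨sPlus ω ⊓ sZero ω, sMinus ω ⊔ Submodule.span ℝ {ω}, fun x hx => hx.1.1, ?_, ?_,
      ?_, ?_, hPpos, hNneg, fun h => absurd h hneg.not_gt, fun _ => ?_⟩
    · refine sup_le (fun x hx => hx.1) ?_
      rw [Submodule.span_singleton_le_iff_mem]
      exact hwt
    · rw [eq_bot_iff]
      rintro x ⟨h1, h2⟩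
      by_contra h0
      exact lt_asymm (hPpos x h1 h0) (hNneg x h2 h0)
    · apply le_antisymm
      · refine sup_le (fun x hx => hx.1.1) (sup_le (fun x hx => hx.1) ?_)
        rw [Submodule.span_singleton_le_iff_mem]
        exact hwt
      · intro h hh
        obtain ⟨a, ha, b, hb, rfl⟩ := split_pm ω h hw hwt hh
        obtain ⟨a', ha', c, rfl⟩ := split_zero ω a hw hwt ha
        refine Submodule.mem_sup.2 ⟨a', ha', b + c • ω, ?_, by abel⟩
        exact Submodule.mem_sup.2 ⟨b, hb, c • ω,
          Submodule.smul_mem _ _ (Submodule.mem_span_singleton_self ω), rfl⟩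
    · intro x hx y hy
      obtain ⟨b, hb, c, rfl⟩ := hNs y hy
      have hx0 : (ω * x).trace = 0 := hx.2
      have h1 := gamma_mixed α ω x b hw hx.1 hb
      have h2 := gamma_zero_omega α ω x hw hx0
      rw [gamma_eq α ω _ _ hw, hx0] at *
      simp only [mul_add, mul_smul_comm, trace_add, trace_smul, mul_zero, zero_mul, add_zero]
        at *
      rw [h1, h2]; simp
    · have h1 := Submodule.finrank_sup_add_finrank_inf_eq (sMinus ω) (Submodule.span ℝ {ω})
      have h2 : sMinus ω ⊓ Submodule.span ℝ {ω} = ⊥ := by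
        rw [eq_bot_iff, ← hpm]
        refine le_inf (inf_le_right.trans ?_) inf_le_left
        rw [Submodule.span_singleton_le_iff_mem]
        exact hωp
      rw [h2, finrank_bot, finrank_span_singleton hω0, hdim] at h1
      simpa using h1
  · refine ⟨sPlus ω, sMinus ω, fun x hx => hx.1, fun x hx => hx.1, hpm, ?_,
      fun x hx y hy => gamma_mixed α ω x y hw hx hy, ?_, ?_, fun _ => hdim,
      fun h => absurd h hpos.not_gt⟩
    · apply le_antisymm
      · exact sup_le (fun x hx => hx.1) (fun x hx => hx.1)
      · intro h hh
        obtain ⟨a, ha, b, hb, rfl⟩ := split_pm ω h hw hwt hh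
        exact Submodule.mem_sup.2 ⟨a, ha, b, hb, rfl⟩
    · intro x hx h0
      obtain ⟨a, ha, c, rfl⟩ := split_zero ω x hw hwt hx
      rw [gamma_add_omega α ω a c hw ha.2, tr_plus ω a a hw ha.1.2]
      by_cases ha0 : a = 0
      · subst ha0
        have hc0 : c ≠ 0 := by rintro rfl; simp at h0
        have : 0 < (c * (Fintype.card (Fin m ⊕ Fin m) : ℝ)) ^ 2 := by positivity
        simp only [mul_zero, trace_zero, neg_zero, zero_add]
        exact mul_pos hpos this
      · have := frob_pos a ha.1.1 ha0
        have h2 := sq_nonneg (c * (Fintype.card (Fin m ⊕ Fin m) : ℝ))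
        nlinarith
    · intro x hx h0
      rw [gamma_eq α ω x x hw, tr_minus0 ω x hx.2]
      simpa using hmneg x hx h0
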